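/- The infinite series ∑_{k=1}^∞ (H_k · H_{k+1} · H_{k+2} · H_{k+3}) / (k·(k+1)·(k+2)·(k+3)) converges and equals -( 4/9 + (1/6)·ζ(3) )·ζ(2) - (7/24)·ζ(3) + (191/144)·ζ(4) + (1/2)·ζ(5). -/

import Mathlib

/-- `harm k` is the `k`-th harmonic number `H_k = 1 + 1/2 + ⋯ + 1/k`. -/
noncomputable def harm (k : ℕ) : ℝ := ∑ i ∈ Finset.range k, (1 : ℝ) / (i + 1)

/-- `zeta m = ∑_{k=1}^∞ 1/k^m`, the Riemann zeta function at a natural argument. -/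
noncomputable def zeta (m : ℕ) : ℝ := ∑' n : ℕ, (1 : ℝ) / (n + 1) ^ m

open Filter Topology Finset

/-- `powerHarm p k` is the generalized harmonic number `1 + 1/2 ^ p + ⋯ + 1/k ^ p`. -/
noncomputable def powerHarm (p k : ℕ) : ℝ := ∑ i ∈ range k, (1 : ℝ) / (i + 1) ^ p

theorem HasSum.of_eq {f g : ℕ → ℝ} {s t : ℝ} (hg : HasSum g t) (hfg : ∀ k, f k = g k)
    (hst : s = t) : HasSum f s := by
  rw [hst, funext hfg]
  exact hg

theorem harm_zero : harm 0 = 0 := by simp [harm]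

theorem harm_succ (k : ℕ) : harm (k + 1) = harm k + 1 / ((k : ℝ) + 1) := by
  simp [harm, sum_range_succ]

theorem powerHarm_succ (p k : ℕ) :
    powerHarm p (k + 1) = powerHarm p k + 1 / ((k : ℝ) + 1) ^ p := by
  simp [powerHarm, sum_range_succ]

theorem harm_nonneg (k : ℕ) : 0 ≤ harm k := sum_nonneg fun i _ => by positivity

theorem powerHarm_nonneg (p k : ℕ) : 0 ≤ powerHarm p k := sum_nonneg fun i _ => by positivity

theorem harm_le_rpow {k : ℕ} (hk : 1 ≤ k) : harm k ≤ 9 * (k : ℝ) ^ (1 / 8 : ℝ) := by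
  have hk' : (1 : ℝ) ≤ k := by exact_mod_cast hk
  have hharm : harm k = (harmonic k : ℝ) := by simp [harm, harmonic]
  have hlog := Real.log_le_rpow_div (x := (k : ℝ)) (ε := 1 / 8) (by positivity) (by norm_num)
  have hone : (1 : ℝ) ≤ (k : ℝ) ^ (1 / 8 : ℝ) := Real.one_le_rpow hk' (by norm_num)
  have hle := harmonic_le_one_add_log k
  rw [hharm]
  linarith

theorem tendsto_harm_pow_div {a : ℕ} (ha : a ≤ 4) (j : ℕ) {p : ℕ} (hp : 1 ≤ p) :
    Tendsto (fun k : ℕ => harm k ^ a / ((k : ℝ) + j) ^ p) atTop (𝓝 0) := by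
  have hlim : Tendsto (fun k : ℕ => (9 : ℝ) ^ 4 * (k : ℝ) ^ (-(1 / 2 : ℝ))) atTop (𝓝 0) := by
    simpa using ((tendsto_rpow_neg_atTop (y := 1 / 2) (by norm_num)).comp
      tendsto_natCast_atTop_atTop).const_mul ((9 : ℝ) ^ 4)
  refine squeeze_zero' (Eventually.of_forall fun k => ?_) ?_ hlim
  · have := harm_nonneg k
    positivity
  filter_upwards [eventually_ge_atTop 1] with k hk
  have hk' : (1 : ℝ) ≤ k := by exact_mod_cast hk
  have hpos : (0 : ℝ) < k := by linarith
  have hone : (1 : ℝ) ≤ (k : ℝ) ^ (1 / 8 : ℝ) := Real.one_le_rpow hk' (by norm_num)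
  have hnum : harm k ^ a ≤ 9 ^ 4 * (k : ℝ) ^ (1 / 2 : ℝ) := by
    calc harm k ^ a ≤ (9 * (k : ℝ) ^ (1 / 8 : ℝ)) ^ a :=
          pow_le_pow_left₀ (harm_nonneg k) (harm_le_rpow hk) a
      _ ≤ (9 * (k : ℝ) ^ (1 / 8 : ℝ)) ^ 4 := pow_le_pow_right₀ (by linarith) ha
      _ = 9 ^ 4 * (k : ℝ) ^ (1 / 2 : ℝ) := by
          rw [mul_pow, ← Real.rpow_natCast ((k : ℝ) ^ (1 / 8 : ℝ)), ← Real.rpow_mul hpos.le]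
          norm_num
  have hden : (k : ℝ) ≤ ((k : ℝ) + j) ^ p := by
    have hj : (0 : ℝ) ≤ j := by positivity
    calc (k : ℝ) ≤ (k : ℝ) + j := by linarith
      _ ≤ ((k : ℝ) + j) ^ p := le_self_pow₀ (by linarith) (by lia)
  calc harm k ^ a / ((k : ℝ) + j) ^ p ≤ (9 ^ 4 * (k : ℝ) ^ (1 / 2 : ℝ)) / k := by gcongr
    _ = 9 ^ 4 * (k : ℝ) ^ (-(1 / 2 : ℝ)) := by
        rw [mul_div_assoc, ← Real.rpow_sub_one hpos.ne']
        norm_num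

theorem summable_harm_pow_div {a p : ℕ} (ha : a ≤ 2) (hp : 2 ≤ p) :
    Summable fun k : ℕ => harm (k + 1) ^ a / ((k : ℝ) + 1) ^ p := by
  have hsum : Summable fun k : ℕ => (9 : ℝ) ^ 2 * ((k + 1 : ℕ) : ℝ) ^ (-(7 / 4 : ℝ)) :=
    ((summable_nat_add_iff 1).2 (Real.summable_nat_rpow.2 (by norm_num))).mul_left _
  refine hsum.of_nonneg_of_le (fun k => ?_) fun k => ?_
  · have := harm_nonneg (k + 1)
    positivity
  have hk' : (1 : ℝ) ≤ ((k + 1 : ℕ) : ℝ) := by push_cast; linarith [k.cast_nonneg (α := ℝ)]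
  rw [show (k : ℝ) + 1 = ((k + 1 : ℕ) : ℝ) by push_cast; ring]
  have hle := harm_le_rpow (k := k + 1) (by lia)
  have hnonneg := harm_nonneg (k + 1)
  generalize ((k + 1 : ℕ) : ℝ) = x at *
  have hpos : (0 : ℝ) < x := by linarith
  have hone : (1 : ℝ) ≤ x ^ (1 / 8 : ℝ) := Real.one_le_rpow hk' (by norm_num)
  have hnum : harm (k + 1) ^ a ≤ 9 ^ 2 * x ^ (1 / 4 : ℝ) := by
    calc harm (k + 1) ^ a ≤ (9 * x ^ (1 / 8 : ℝ)) ^ a := pow_le_pow_left₀ hnonneg hle a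
      _ ≤ (9 * x ^ (1 / 8 : ℝ)) ^ 2 := pow_le_pow_right₀ (by linarith) ha
      _ = 9 ^ 2 * x ^ (1 / 4 : ℝ) := by
          rw [mul_pow, ← Real.rpow_natCast (x ^ (1 / 8 : ℝ)), ← Real.rpow_mul hpos.le]
          norm_num
  have hden : x ^ 2 ≤ x ^ p := pow_le_pow_right₀ hk' hp
  calc harm (k + 1) ^ a / x ^ p ≤ (9 ^ 2 * x ^ (1 / 4 : ℝ)) / x ^ 2 := by gcongr
    _ = 9 ^ 2 * x ^ (-(7 / 4 : ℝ)) := by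
        rw [mul_div_assoc, ← Real.rpow_natCast x 2, ← Real.rpow_sub hpos]
        norm_num

theorem hasSum_zeta {p : ℕ} (hp : 2 ≤ p) :
    HasSum (fun k : ℕ => (1 : ℝ) / ((k : ℝ) + 1) ^ p) (zeta p) := by
  have h := summable_harm_pow_div (a := 0) (by norm_num) hp
  simp only [pow_zero] at h
  exact h.hasSum

theorem zeta_eq_of_hasSum {p : ℕ} (hp : 2 ≤ p) {s : ℝ}
    (h : HasSum (fun n : ℕ => (1 : ℝ) / (n : ℝ) ^ p) s) : zeta p = s := by
  have h' := (hasSum_nat_add_iff' 1).2 h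
  have hp0 : p ≠ 0 := by lia
  refine (hasSum_zeta hp).unique ?_
  simpa [hp0] using h'

theorem zeta_two_sq : zeta 2 ^ 2 = 5 / 2 * zeta 4 := by
  rw [zeta_eq_of_hasSum le_rfl hasSum_zeta_two, zeta_eq_of_hasSum (by norm_num) hasSum_zeta_four]
  ring

/-- The symmetric product formula for the linear Euler sums of exponents `p` and `q`. -/
theorem hasSum_powerHarm_symm {p q : ℕ} (hp : 2 ≤ p) (hq : 2 ≤ q) :
    HasSum (fun k : ℕ => powerHarm p (k + 1) / ((k : ℝ) + 1) ^ q
      + powerHarm q (k + 1) / ((k : ℝ) + 1) ^ p) (zeta p * zeta q + zeta (p + q)) := by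
  rw [hasSum_iff_tendsto_nat_of_nonneg]
  · have hlim := ((hasSum_zeta hp).tendsto_sum_nat.mul (hasSum_zeta hq).tendsto_sum_nat).add
      (hasSum_zeta (show 2 ≤ p + q by lia)).tendsto_sum_nat
    refine hlim.congr fun n => ?_
    change powerHarm p n * powerHarm q n + powerHarm (p + q) n = _
    induction n with
    | zero => simp [powerHarm]
    | succ n ih =>
      rw [sum_range_succ, ← ih]
      simp only [powerHarm_succ]
      rw [pow_add]
      field_simp
      ring
  · intro k
    have := powerHarm_nonneg p (k + 1)
    have := powerHarm_nonneg q (k + 1)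
    positivity

theorem harm_add_sub_tendsto (j : ℕ) :
    Tendsto (fun k : ℕ => harm (k + j) - harm k) atTop (𝓝 0) := by
  induction j with
  | zero => simp
  | succ j ih =>
    have h := ih.add ((tendsto_one_div_add_atTop_nhds_zero_nat (𝕜 := ℝ)).comp
      (tendsto_add_atTop_nat j))
    rw [add_zero] at h
    refine h.congr fun k => ?_
    rw [← add_assoc, harm_succ]
    simp only [Function.comp_apply]
    ring

theorem hasSum_one_div_mul_add (n : ℕ) :
    HasSum (fun m : ℕ => 1 / (((m : ℝ) + 1) * ((m : ℝ) + n + 2)))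
      (harm (n + 1) / ((n : ℝ) + 1)) := by
  rw [hasSum_iff_tendsto_nat_of_nonneg fun m => by positivity]
  have h := ((harm_add_sub_tendsto (n + 1)).const_sub (harm (n + 1))).div_const ((n : ℝ) + 1)
  rw [sub_zero] at h
  refine h.congr fun k => ?_
  induction k with
  | zero => simp [harm_zero]
  | succ k ih =>
    rw [sum_range_succ, ← ih, show k + 1 + (n + 1) = k + (n + 1) + 1 by ring,
      harm_succ (k + (n + 1)), harm_succ k]
    push_cast
    field_simp
    ring

/-- Summation of a nonnegative double series by rows and along antidiagonals. -/
theorem HasSum.antidiagonal_of_nonneg {f : ℕ → ℕ → ℝ} {g : ℕ → ℝ} {s : ℝ}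
    (hf : ∀ n m, 0 ≤ f n m) (hrow : ∀ n, HasSum (f n) (g n)) (hg : HasSum g s) :
    HasSum (fun N => ∑ x ∈ antidiagonal N, f x.1 x.2) s := by
  have hsum : Summable fun x : ℕ × ℕ => f x.1 x.2 := by
    rw [summable_prod_of_nonneg fun x => hf x.1 x.2]
    refine ⟨fun n => (hrow n).summable, ?_⟩
    simpa only [(hrow _).tsum_eq] using hg.summable
  have hs : HasSum (fun x : ℕ × ℕ => f x.1 x.2) s := by
    have h := hsum.hasSum
    rwa [(h.prod_fiberwise hrow).unique hg] at h
  refine ((HasAntidiagonal.sigmaAntidiagonalEquivProd (A := ℕ)).hasSum_iff.2 hs).sigma fun N => ?_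
  simpa [← sum_coe_sort (antidiagonal N)] using
    hasSum_fintype fun x : antidiagonal N => f x.1.1 x.1.2

theorem hasSum_convolution {c : ℕ → ℝ} {s : ℝ} (hc : ∀ n, 0 ≤ c n)
    (hs : HasSum (fun n : ℕ => c n * (harm (n + 1) / ((n : ℝ) + 1))) s) :
    HasSum (fun M : ℕ => (∑ i ∈ range M, c i / ((M : ℝ) - i)) / ((M : ℝ) + 1)) s := by
  have h := HasSum.antidiagonal_of_nonneg
    (f := fun n m => c n * (1 / (((m : ℝ) + 1) * ((m : ℝ) + n + 2))))
    (fun n m => mul_nonneg (hc n) (by positivity))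
    (fun n => (hasSum_one_div_mul_add n).mul_left (c n)) hs
  rw [← hasSum_nat_add_iff' 1]
  simp only [range_one, sum_singleton, range_zero, sum_empty, zero_div, sub_zero]
  refine h.of_eq (fun N => ?_) rfl
  rw [Nat.sum_antidiagonal_eq_sum_range_succ
    (fun n m => c n * (1 / (((m : ℝ) + 1) * ((m : ℝ) + n + 2)))), sum_div]
  refine sum_congr rfl fun i hi => ?_
  have hi' : i ≤ N := by simpa [Nat.lt_succ_iff] using hi
  rw [Nat.cast_sub hi', div_div, mul_one_div]
  push_cast
  congr 1
  ring

theorem sum_one_div_sub (M : ℕ) : ∑ i ∈ range M, 1 / ((M : ℝ) - i) = harm M := by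
  rw [harm, ← sum_range_reflect]
  refine sum_congr rfl fun i hi => ?_
  have hi' : i + 1 ≤ M := by simpa [Nat.succ_le_iff] using hi
  rw [Nat.sub_sub, add_comm 1 i, Nat.cast_sub hi']
  push_cast
  congr 1
  ring

/-- Partial fraction reduction of a convolution with `1 / (i + 1)`. -/
theorem sum_div_succ_div_sub (d : ℕ → ℝ) (M : ℕ) :
    ∑ i ∈ range M, d i / ((i : ℝ) + 1) / ((M : ℝ) - i)
      = (∑ i ∈ range M, d i / ((i : ℝ) + 1) + ∑ i ∈ range M, d i / ((M : ℝ) - i))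
        / ((M : ℝ) + 1) := by
  rw [← sum_add_distrib, sum_div]
  refine sum_congr rfl fun i hi => ?_
  have hi' : (i : ℝ) < M := by exact_mod_cast mem_range.1 hi
  have hpos : (M : ℝ) - i ≠ 0 := by linarith
  field_simp
  ring

theorem sum_one_div_succ_div_sub (M : ℕ) :
    ∑ i ∈ range M, 1 / ((i : ℝ) + 1) / ((M : ℝ) - i) = 2 * harm M / ((M : ℝ) + 1) := by
  rw [sum_div_succ_div_sub fun _ => 1, sum_one_div_sub, ← harm, two_mul]

theorem sum_one_div_succ_pow_div_sub (p M : ℕ) :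
    ∑ i ∈ range M, 1 / ((i : ℝ) + 1) ^ (p + 1) / ((M : ℝ) - i)
      = (powerHarm (p + 1) M + ∑ i ∈ range M, 1 / ((i : ℝ) + 1) ^ p / ((M : ℝ) - i))
        / ((M : ℝ) + 1) := by
  have h := sum_div_succ_div_sub (fun i => 1 / ((i : ℝ) + 1) ^ p) M
  simp only [div_div, ← pow_succ] at h ⊢
  exact h

theorem sum_harm_div_succ (M : ℕ) :
    ∑ i ∈ range M, harm (i + 1) / ((i : ℝ) + 1) = (harm M ^ 2 + powerHarm 2 M) / 2 := by
  induction M with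
  | zero => simp [harm, powerHarm]
  | succ M ih =>
    rw [sum_range_succ, ih, powerHarm_succ, harm_succ]
    field_simp
    ring

theorem sum_harm_div_sub (M : ℕ) :
    ∑ i ∈ range M, harm (i + 1) / ((M : ℝ) - i) = harm (M + 1) ^ 2 - powerHarm 2 (M + 1) := by
  induction M with
  | zero => simp [harm, powerHarm]
  | succ M ih =>
    have hconv := sum_one_div_succ_div_sub (M + 1)
    rw [sum_range_succ'] at hconv ⊢
    have hstep : ∑ i ∈ range M, harm (i + 1 + 1) / (((M + 1 : ℕ) : ℝ) - ((i + 1 : ℕ) : ℝ))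
        = ∑ i ∈ range M, harm (i + 1) / ((M : ℝ) - i)
          + ∑ i ∈ range M, 1 / (((i + 1 : ℕ) : ℝ) + 1)
            / (((M + 1 : ℕ) : ℝ) - ((i + 1 : ℕ) : ℝ)) := by
      rw [← sum_add_distrib]
      refine sum_congr rfl fun i _ => ?_
      rw [harm_succ (i + 1), add_div]
      push_cast
      rw [add_sub_add_right_eq_sub]
    rw [hstep, ih, eq_sub_of_add_eq hconv, harm_succ (M + 1), powerHarm_succ 2 (M + 1),
      harm_succ 0, harm_zero]
    push_cast
    field_simp
    ring

theorem hasSum_harm_div_sq :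
    HasSum (fun k : ℕ => harm (k + 1) / ((k : ℝ) + 1) ^ 2) (2 * zeta 3) := by
  have hW := (summable_harm_pow_div (a := 1) (p := 2) (by norm_num) (by norm_num)).hasSum
  simp only [pow_one] at hW
  set W := ∑' k : ℕ, harm (k + 1) / ((k : ℝ) + 1) ^ 2
  have hconv := hasSum_convolution (c := fun n => 1 / ((n : ℝ) + 1)) (s := W)
    (fun n => by positivity) (by convert hW using 2 with n; field_simp)
  have hlin := (hW.mul_left 2).sub ((hasSum_zeta (p := 3) (by norm_num)).mul_left 2)
  have heq : W = 2 * W - 2 * zeta 3 := by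
    refine hconv.unique ?_
    refine hlin.of_eq (fun M => ?_) rfl
    rw [sum_one_div_succ_div_sub, harm_succ]
    field_simp
    ring
  rwa [show W = 2 * zeta 3 by linarith] at hW

theorem hasSum_powerHarm_two_div_sq :
    HasSum (fun k : ℕ => powerHarm 2 (k + 1) / ((k : ℝ) + 1) ^ 2) (7 / 4 * zeta 4) := by
  have h := (hasSum_powerHarm_symm (p := 2) (q := 2) le_rfl le_rfl).div_const 2
  rw [← sq, zeta_two_sq, show (5 / 2 * zeta 4 + zeta (2 + 2)) / 2 = 7 / 4 * zeta 4 by ring] at h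
  refine h.of_eq (fun k => ?_) rfl
  ring

theorem hasSum_harm_div_cube :
    HasSum (fun k : ℕ => harm (k + 1) / ((k : ℝ) + 1) ^ 3) (5 / 4 * zeta 4) := by
  have hW := (summable_harm_pow_div (a := 1) (p := 3) (by norm_num) (by norm_num)).hasSum
  simp only [pow_one] at hW
  set W := ∑' k : ℕ, harm (k + 1) / ((k : ℝ) + 1) ^ 3
  have hconv := hasSum_convolution (c := fun n => 1 / ((n : ℝ) + 1) ^ (1 + 1)) (s := W)
    (fun n => by positivity) (by convert hW using 2 with n; field_simp)
  have hlin := (hasSum_powerHarm_two_div_sq.add (hW.mul_left 2)).sub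
    ((hasSum_zeta (p := 4) (by norm_num)).mul_left 3)
  have heq : W = 7 / 4 * zeta 4 + 2 * W - 3 * zeta 4 := by
    refine hconv.unique ?_
    refine hlin.of_eq (fun M => ?_) rfl
    rw [sum_one_div_succ_pow_div_sub]
    simp only [pow_one, sum_one_div_succ_div_sub]
    rw [harm_succ, powerHarm_succ]
    field_simp
    ring
  rwa [show W = 5 / 4 * zeta 4 by linarith] at hW

theorem hasSum_harm_div_pow_four :
    HasSum (fun k : ℕ => harm (k + 1) / ((k : ℝ) + 1) ^ 4)
      (3 * zeta 5 - zeta 2 * zeta 3) := by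
  have hW := (summable_harm_pow_div (a := 1) (p := 4) (by norm_num) (by norm_num)).hasSum
  simp only [pow_one] at hW
  set W := ∑' k : ℕ, harm (k + 1) / ((k : ℝ) + 1) ^ 4
  have hconv := hasSum_convolution (c := fun n => 1 / ((n : ℝ) + 1) ^ (1 + 1 + 1)) (s := W)
    (fun n => by positivity) (by convert hW using 2 with n; field_simp)
  have hlin := ((hasSum_powerHarm_symm (p := 2) (q := 3) (by norm_num) (by norm_num)).add
    (hW.mul_left 2)).sub ((hasSum_zeta (p := 5) (by norm_num)).mul_left 4)
  have heq : W = zeta 2 * zeta 3 + zeta 5 + 2 * W - 4 * zeta 5 := by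
    refine hconv.unique ?_
    refine hlin.of_eq (fun M => ?_) rfl
    rw [sum_one_div_succ_pow_div_sub, sum_one_div_succ_pow_div_sub]
    simp only [pow_one, sum_one_div_succ_div_sub]
    rw [harm_succ, powerHarm_succ, powerHarm_succ]
    field_simp
    ring
  rwa [show W = 3 * zeta 5 - zeta 2 * zeta 3 by linarith] at hW

theorem hasSum_harm_sq_div_sq :
    HasSum (fun k : ℕ => harm (k + 1) ^ 2 / ((k : ℝ) + 1) ^ 2) (17 / 4 * zeta 4) := by
  have hA := (summable_harm_pow_div (a := 2) (p := 2) (by norm_num) (by norm_num)).hasSum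
  set A := ∑' k : ℕ, harm (k + 1) ^ 2 / ((k : ℝ) + 1) ^ 2
  have hconv := hasSum_convolution (c := fun n => harm (n + 1) / ((n : ℝ) + 1)) (s := A)
    (fun n => div_nonneg (harm_nonneg _) (by positivity))
    (by convert hA using 2 with n; field_simp)
  have hlin := ((hA.mul_left (3 / 2)).sub hasSum_harm_div_cube).sub
    (hasSum_powerHarm_two_div_sq.mul_left (1 / 2))
  have heq : A = 3 / 2 * A - 5 / 4 * zeta 4 - 1 / 2 * (7 / 4 * zeta 4) := by
    refine hconv.unique ?_
    refine hlin.of_eq (fun M => ?_) rfl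
    rw [sum_div_succ_div_sub, sum_harm_div_succ, sum_harm_div_sub, harm_succ, powerHarm_succ]
    field_simp
    ring
  rwa [show A = 17 / 4 * zeta 4 by linarith] at hA

/-- The telescoping part of the summand, as a function of `h = harm k` and `x = k`. -/
noncomputable def telescopingPart (h x : ℝ) : ℝ :=
  (-1 / 6 * h ^ 4 + 5 / 18 * h ^ 3 + 67 / 36 * h ^ 2 - 5 / 12 * h) / (x + 1)
    + (-2 / 3 * h ^ 3 - 5 / 12 * h ^ 2 + 11 / 8 * h) / (x + 1) ^ 2
    + (-h ^ 2 - 1 / 2 * h) / (x + 1) ^ 3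
    + (-1 / 2 * h) / (x + 1) ^ 4
    + (1 / 3 * h ^ 4 - 5 / 9 * h ^ 3 - 133 / 72 * h ^ 2 + 77 / 72 * h) / (x + 2)
    + (5 / 6 * h ^ 3 - 7 / 6 * h ^ 2 - 1 / 6 * h) / (x + 2) ^ 2
    + (1 / 2 * h ^ 2 - 1 / 2 * h) / (x + 2) ^ 3
    + (-1 / 6 * h ^ 4 + 5 / 18 * h ^ 3 + 17 / 72 * h ^ 2 - 5 / 24 * h) / (x + 3)
    + (-1 / 6 * h ^ 3 + 1 / 3 * h ^ 2 - 1 / 8 * h) / (x + 3) ^ 2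

/-- The part of the summand left after telescoping, as a function of `h = harm (k + 1)` and
`y = k + 1`. -/
noncomputable def eulerPart (h y : ℝ) : ℝ :=
  1 / 6 * (h / y ^ 4) + 1 / 4 * (h ^ 2 / y ^ 2) + 1 / 6 * (h / y ^ 3) + 1 / 18 * (1 / y ^ 4)
    - 1 / 18 * (h / y ^ 2) - 13 / 72 * (1 / y ^ 3) - 4 / 9 * (1 / y ^ 2)

theorem tendsto_telescopingPart :
    Tendsto (fun k : ℕ => telescopingPart (harm k) k) atTop (𝓝 0) := by
  have hlim (c : ℝ) (a j p : ℕ) (ha : a ≤ 4) (hp : 1 ≤ p) :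
      Tendsto (fun k : ℕ => c * (harm k ^ a / ((k : ℝ) + j) ^ p)) atTop (𝓝 0) := by
    simpa using (tendsto_harm_pow_div ha j hp).const_mul c
  have hquartic (c₁ c₂ c₃ c₄ : ℝ) (j p : ℕ) (hp : 1 ≤ p) :
      Tendsto (fun k : ℕ => (c₄ * harm k ^ 4 + c₃ * harm k ^ 3 + c₂ * harm k ^ 2 + c₁ * harm k)
        / ((k : ℝ) + j) ^ p) atTop (𝓝 0) := by
    have h := (((hlim c₄ 4 j p (by norm_num) hp).add (hlim c₃ 3 j p (by norm_num) hp)).add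
      (hlim c₂ 2 j p (by norm_num) hp)).add (hlim c₁ 1 j p (by norm_num) hp)
    simp only [add_zero] at h
    refine h.congr fun k => ?_
    ring
  have h := ((((((((hquartic (-5 / 12) (67 / 36) (5 / 18) (-1 / 6) 1 1 (by norm_num)).add
    (hquartic (11 / 8) (-5 / 12) (-2 / 3) 0 1 2 (by norm_num))).add
    (hquartic (-1 / 2) (-1) 0 0 1 3 (by norm_num))).add
    (hquartic (-1 / 2) 0 0 0 1 4 (by norm_num))).add
    (hquartic (77 / 72) (-133 / 72) (-5 / 9) (1 / 3) 2 1 (by norm_num))).add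
    (hquartic (-1 / 6) (-7 / 6) (5 / 6) 0 2 2 (by norm_num))).add
    (hquartic (-1 / 2) (1 / 2) 0 0 2 3 (by norm_num))).add
    (hquartic (-5 / 24) (17 / 72) (5 / 18) (-1 / 6) 3 1 (by norm_num))).add
    (hquartic (-1 / 8) (1 / 3) (-1 / 6) 0 3 2 (by norm_num))
  simp only [add_zero] at h
  refine h.congr fun k => ?_
  simp only [telescopingPart]
  push_cast
  ring

theorem harm_product_decomposition (h x : ℝ) (hx : 0 ≤ x) :
    (h + 1 / (x + 1)) * (h + 1 / (x + 1) + 1 / (x + 2))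
        * (h + 1 / (x + 1) + 1 / (x + 2) + 1 / (x + 3))
        * (h + 1 / (x + 1) + 1 / (x + 2) + 1 / (x + 3) + 1 / (x + 4))
        / ((x + 1) * (x + 2) * (x + 3) * (x + 4))
      = telescopingPart (h + 1 / (x + 1)) (x + 1) - telescopingPart h x
        + eulerPart (h + 1 / (x + 1)) (x + 1) := by
  unfold telescopingPart eulerPart
  rw [show x + 1 + 1 = x + 2 by ring, show x + 1 + 2 = x + 3 by ring,
    show x + 1 + 3 = x + 4 by ring]
  have h1 : x + 1 ≠ 0 := by positivity
  have h2 : x + 2 ≠ 0 := by positivity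
  have h3 : x + 3 ≠ 0 := by positivity
  have h4 : x + 4 ≠ 0 := by positivity
  field_simp
  ring

theorem hasSum_eulerPart :
    HasSum (fun k : ℕ => eulerPart (harm (k + 1)) ((k : ℝ) + 1))
      (-(4 / 9 + (1 / 6) * zeta 3) * zeta 2 - (7 / 24) * zeta 3
        + (191 / 144) * zeta 4 + (1 / 2) * zeta 5) := by
  have h := ((((((hasSum_harm_div_pow_four.mul_left (1 / 6)).add
    (hasSum_harm_sq_div_sq.mul_left (1 / 4))).add
    (hasSum_harm_div_cube.mul_left (1 / 6))).add
    ((hasSum_zeta (p := 4) (by norm_num)).mul_left (1 / 18))).sub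
    (hasSum_harm_div_sq.mul_left (1 / 18))).sub
    ((hasSum_zeta (p := 3) (by norm_num)).mul_left (13 / 72))).sub
    ((hasSum_zeta (p := 2) (by norm_num)).mul_left (4 / 9))
  refine h.of_eq (fun k => rfl) ?_
  ring

theorem stmt_16 :
    HasSum (fun k : ℕ =>
      (harm (k + 1) * harm (k + 2) * harm (k + 3) * harm (k + 4)) /
        (((k : ℝ) + 1) * ((k : ℝ) + 2) * ((k : ℝ) + 3) * ((k : ℝ) + 4)))
      (-(4 / 9 + (1 / 6) * zeta 3) * zeta 2 - (7 / 24) * zeta 3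
        + (191 / 144) * zeta 4 + (1 / 2) * zeta 5) := by
  rw [hasSum_iff_tendsto_nat_of_nonneg]
  · have hlim := tendsto_telescopingPart.add hasSum_eulerPart.tendsto_sum_nat
    rw [zero_add] at hlim
    refine hlim.congr fun n => ?_
    induction n with
    | zero => simp [telescopingPart, harm_zero]
    | succ n ih =>
      have hdecomp := harm_product_decomposition (harm n) n n.cast_nonneg
      rw [sum_range_succ, sum_range_succ, ← ih, harm_succ (n + 3), harm_succ (n + 2),
        harm_succ (n + 1), harm_succ n]
      push_cast
      rw [show (n : ℝ) + 1 + 1 = n + 2 by ring, show (n : ℝ) + 2 + 1 = n + 3 by ring,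
        show (n : ℝ) + 3 + 1 = n + 4 by ring, hdecomp]
      ring
  · intro k
    have := harm_nonneg
    exact div_nonneg (mul_nonneg (mul_nonneg (mul_nonneg (this _) (this _)) (this _)) (this _))
      (by positivity)
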